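/- arXiv:math/0308263 — 3 statements merged into one kernel-verified Lean document; each statement's English description precedes it below -/
import Mathlib

section
/- For every integer s ≥ 1, the R-module R/I^s admits a free resolution of length n by finitely generated free R-modules; in particular, R/I^s has projective dimension at most n as an R-module. -/
open CategoryTheory

lemma ffr_desc {R A N P : Type} [CommRing R] [AddCommGroup A] [Module R A] [AddCommGroup N]
    [Module R N] [AddCommGroup P] [Module R P] (g : A →ₗ[R] N) (hg : Function.Surjective g)
    (h : A →ₗ[R] P) (H : ∀ a, g a = 0 → h a = 0) : ∃ k : N →ₗ[R] P, ∀ a, k (g a) = h a := by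
  refine ⟨(LinearMap.ker g).liftQ h (fun a ha => H a ha) ∘ₗ
    (g.quotKerEquivOfSurjective hg).symm.toLinearMap, fun a => ?_⟩
  have : (g.quotKerEquivOfSurjective hg).symm (g a) = (LinearMap.ker g).mkQ a := by
    rw [LinearEquiv.symm_apply_eq]; rfl
  rw [LinearMap.comp_apply, LinearEquiv.coe_coe, this]
  rfl

lemma ffr_lift {R A B K : Type} [CommRing R] [AddCommGroup A] [Module R A] [AddCommGroup B]
    [Module R B] [AddCommGroup K] [Module R K] (g : A →ₗ[R] B) (hg : Function.Injective g)
    (h : K →ₗ[R] B) (H : ∀ k, ∃ a, g a = h k) : ∃ l : K →ₗ[R] A, ∀ k, g (l k) = h k := by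
  refine ⟨(LinearEquiv.ofInjective g hg).symm.toLinearMap ∘ₗ
    h.codRestrict (LinearMap.range g) H, fun k => ?_⟩
  have := LinearEquiv.apply_symm_apply (LinearEquiv.ofInjective g hg)
    (h.codRestrict (LinearMap.range g) H k)
  exact congrArg Subtype.val this

/-- `M` has a finite free resolution of length at most `n`. -/
def FFR (R : Type) [CommRing R] : ℕ → ∀ (M : Type) [AddCommGroup M] [Module R M], Prop
  | 0, M, _, _ => Module.Free R M ∧ Module.Finite R M
  | n + 1, M, _, _ => ∃ (F : Type) (_ : AddCommGroup F) (_ : Module R F) (f : F →ₗ[R] M),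
      Module.Free R F ∧ Module.Finite R F ∧ Function.Surjective f ∧ FFR R n (LinearMap.ker f)

/-- Property closed under extensions. -/
def ExtCl (R : Type) [CommRing R]
    (T : ∀ (M : Type) [AddCommGroup M] [Module R M], Prop) : Prop :=
  ∀ (A B C : Type) [AddCommGroup A] [Module R A] [AddCommGroup B] [Module R B]
    [AddCommGroup C] [Module R C] (f : A →ₗ[R] B) (g : B →ₗ[R] C),
    Function.Injective f → Function.Surjective g → Function.Exact f g → T A → T C → T B

lemma ffr_mono (R : Type) [CommRing R] (n : ℕ) : ∀ (M : Type) [AddCommGroup M] [Module R M],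
    FFR R n M → FFR R (n + 1) M := by
  induction n with
  | zero =>
    intro M _ _ h
    refine ⟨M, _, _, LinearMap.id, h.1, h.2, fun x => ⟨x, rfl⟩, ?_⟩
    have : Subsingleton (LinearMap.ker (LinearMap.id : M →ₗ[R] M)) := by
      rw [LinearMap.ker_id]; infer_instance
    exact ⟨inferInstance, inferInstance⟩
  | succ n ih =>
    rintro M _ _ ⟨F, _, _, f, h1, h2, h3, h4⟩
    exact ⟨F, _, _, f, h1, h2, h3, ih _ h4⟩

lemma ffr_ext (R : Type) [CommRing R] (n : ℕ) : ExtCl R (fun M _ _ => FFR R n M) := by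
  induction n with
  | zero =>
    intro A B C _ _ _ _ _ _ f g hf hg hfg hA hC
    obtain ⟨hA1, hA2⟩ := hA
    obtain ⟨hC1, hC2⟩ := hC
    obtain ⟨l, hl⟩ := Module.projective_lifting_property g LinearMap.id hg
    obtain ⟨e, -⟩ := hfg.splitSurjectiveEquiv hf ⟨l, hl⟩
    exact ⟨Module.Free.of_equiv e.symm, Module.Finite.equiv e.symm⟩
  | succ n ih =>
    intro A B C _ _ _ _ _ _ f g hf hg hfg hA hC
    obtain ⟨P, _, _, p, hP1, hP2, hp, hPk⟩ := hA
    obtain ⟨Q, _, _, q, hQ1, hQ2, hq, hQk⟩ := hC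
    obtain ⟨l, hl⟩ := Module.projective_lifting_property g q hg
    have hl' : ∀ y, g (l y) = q y := fun y => LinearMap.congr_fun hl y
    have hgf : ∀ a, g (f a) = 0 := fun a => hfg.apply_apply_eq_zero a
    let φ : (P × Q) →ₗ[R] B := (f ∘ₗ p).coprod l
    have hφ : ∀ x y, φ (x, y) = f (p x) + l y := fun x y => by simp [φ]
    refine ⟨P × Q, _, _, φ, inferInstance, inferInstance, ?_, ?_⟩
    · intro b
      obtain ⟨y, hy⟩ := hq (g b)
      have : g (b - l y) = 0 := by rw [map_sub, hl', hy, sub_self]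
      obtain ⟨a, ha⟩ := (hfg _).1 this
      obtain ⟨x, rfl⟩ := hp a
      exact ⟨(x, y), by rw [hφ, ha]; abel⟩
    · have key : ∀ x y, φ (x, y) = 0 → q y = 0 := by
        intro x y h
        have := congrArg g h
        rwa [hφ, map_add, hgf, zero_add, hl', map_zero] at this
      refine ih (LinearMap.ker p) (LinearMap.ker φ) (LinearMap.ker q)
        ((LinearMap.inl R P Q).restrict (fun x hx => ?_))
        ((LinearMap.snd R P Q).restrict (fun z hz => ?_)) ?_ ?_ ?_ hPk hQk
      · rw [LinearMap.mem_ker] at *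
        rw [LinearMap.inl_apply, hφ, hx]; simp
      · exact key z.1 z.2 hz
      · intro x y h
        have := congrArg (fun z => z.1.1) h
        exact Subtype.ext this
      · rintro ⟨y, hy⟩
        have hy' : q y = 0 := hy
        obtain ⟨a, ha⟩ := (hfg (l y)).1 (by rw [hl', hy'])
        obtain ⟨x, hx⟩ := hp (-a)
        have hxy : φ (x, y) = 0 := by rw [hφ, hx, map_neg, ha]; abel
        exact ⟨⟨(x, y), hxy⟩, rfl⟩
      · rintro ⟨⟨x, y⟩, hxy⟩
        have hxy' : φ (x, y) = 0 := hxy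
        constructor
        · intro h
          have hy : y = 0 := congrArg Subtype.val h
          subst hy
          refine ⟨⟨x, ?_⟩, rfl⟩
          rw [hφ, map_zero, add_zero] at hxy'
          exact hf (by rw [hxy', map_zero])
        · rintro ⟨⟨x', hx'⟩, h⟩
          have : (0 : Q) = y := congrArg (fun z => z.1.2) h
          exact Subtype.ext this.symm

lemma ffr_cone (R : Type) [CommRing R] (n : ℕ) (A B C : Type) [AddCommGroup A] [Module R A]
    [AddCommGroup B] [Module R B] [AddCommGroup C] [Module R C] (f : A →ₗ[R] B) (g : B →ₗ[R] C)
    (hf : Function.Injective f) (hg : Function.Surjective g) (hfg : Function.Exact f g)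
    (hA : FFR R n A) (hB : FFR R n B) : FFR R (n + 1) C := by
  cases n with
  | zero =>
    obtain ⟨hA1, hA2⟩ := hA
    refine ⟨B, _, _, g, hB.1, hB.2, hg, ?_⟩
    have e : A ≃ₗ[R] LinearMap.ker g :=
      (LinearEquiv.ofInjective f hf).trans (LinearEquiv.ofEq _ _ hfg.linearMap_ker_eq.symm)
    exact ⟨Module.Free.of_equiv e, Module.Finite.equiv e⟩
  | succ n =>
    obtain ⟨F, _, _, p, hF1, hF2, hp, hk⟩ := hB
    refine ⟨F, _, _, g ∘ₗ p, hF1, hF2, hg.comp hp, ?_⟩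
    obtain ⟨l, hl⟩ := ffr_lift f hf (p ∘ₗ (LinearMap.ker (g ∘ₗ p)).subtype)
      (fun k => (hfg _).1 k.2)
    refine ffr_ext R (n + 1) (LinearMap.ker p) (LinearMap.ker (g ∘ₗ p)) A
      (Submodule.inclusion (LinearMap.ker_le_ker_comp p g)) l
      (Submodule.inclusion_injective _) ?_ ?_ (ffr_mono R n _ hk) hA
    · intro a
      obtain ⟨x, hx⟩ := hp (f a)
      have : g (p x) = 0 := by rw [hx]; exact hfg.apply_apply_eq_zero a
      exact ⟨⟨x, this⟩, hf (by rw [hl]; exact hx)⟩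
    · intro x
      have hx := hl x
      constructor
      · intro h
        rw [h, map_zero] at hx
        exact ⟨⟨x.1, hx.symm⟩, rfl⟩
      · rintro ⟨y, rfl⟩
        apply hf
        rw [hx, map_zero]
        exact y.2

/-- reduction mod `x` -/
def Red {R : Type} [CommRing R] (x : R) (T : ∀ (M : Type) [AddCommGroup M] [Module R M], Prop)
    (M : Type) [AddCommGroup M] [Module R M] : Prop :=
  (∀ m : M, x • m = 0 → m = 0) ∧ ∃ (N : Type) (_ : AddCommGroup N) (_ : Module R N)
    (g : M →ₗ[R] N), Function.Surjective g ∧ (∀ m, g m = 0 ↔ ∃ m', x • m' = m) ∧ T N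

lemma red_ext {R : Type} [CommRing R] (x : R)
    (T : ∀ (M : Type) [AddCommGroup M] [Module R M], Prop) (hT : ExtCl R T) :
    ExtCl R (fun M _ _ => Red x T M) := by
  intro A B C _ _ _ _ _ _ f g hf hg hfg hA hC
  obtain ⟨hA, NA, _, _, a, ha, hak, hNA⟩ := hA
  obtain ⟨hC, NC, _, _, c, hc, hck, hNC⟩ := hC
  have hgf : ∀ a, g (f a) = 0 := fun a => hfg.apply_apply_eq_zero a
  let S : Submodule R B := LinearMap.range (LinearMap.lsmul R B x)
  have hS : ∀ b, S.mkQ b = 0 ↔ ∃ b', x • b' = b := by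
    intro b
    rw [Submodule.mkQ_apply, Submodule.Quotient.mk_eq_zero]; rfl
  refine ⟨?_, B ⧸ S, inferInstance, inferInstance, S.mkQ, S.mkQ_surjective, hS, ?_⟩
  · intro b hb
    obtain ⟨y, rfl⟩ := (hfg b).1 (hC _ (by rw [← map_smul, hb, map_zero]))
    rw [hA y (hf (by rw [map_smul, hb, map_zero])), map_zero]
  · obtain ⟨u, hu⟩ := ffr_desc a ha (S.mkQ ∘ₗ f) (by
      intro y hy
      obtain ⟨z, rfl⟩ := (hak y).1 hy
      exact (hS _).2 ⟨f z, by rw [map_smul]⟩)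
    obtain ⟨v, hv⟩ := ffr_desc S.mkQ S.mkQ_surjective (c ∘ₗ g) (by
      intro y hy
      obtain ⟨z, rfl⟩ := (hS y).1 hy
      exact (hck _).2 ⟨g z, by rw [map_smul]⟩)
    refine hT NA (B ⧸ S) NC u v ?_ ?_ ?_ hNA hNC
    · rw [injective_iff_map_eq_zero]
      intro y hy
      obtain ⟨y, rfl⟩ := ha y
      rw [hu] at hy
      obtain ⟨b, hb⟩ := (hS _).1 hy
      obtain ⟨z, rfl⟩ := (hfg b).1 (hC _ (by rw [← map_smul, hb, hgf]))
      exact (hak y).2 ⟨z, hf (by rw [map_smul, hb])⟩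
    · intro y
      obtain ⟨y, rfl⟩ := hc y
      obtain ⟨b, rfl⟩ := hg y
      exact ⟨S.mkQ b, hv b⟩
    · intro y
      obtain ⟨b, rfl⟩ := S.mkQ_surjective y
      rw [hv]
      constructor
      · intro h
        obtain ⟨d, hd⟩ := (hck _).1 h
        obtain ⟨b', rfl⟩ := hg d
        obtain ⟨z, hz⟩ := (hfg (b - x • b')).1 (by rw [map_sub, map_smul, hd, sub_self])
        refine ⟨a z, ?_⟩
        rw [hu, LinearMap.comp_apply, hz, map_sub, (hS (x • b')).2 ⟨b', rfl⟩, sub_zero]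
      · rintro ⟨z, hz⟩
        obtain ⟨z, rfl⟩ := ha z
        rw [hu] at hz
        have := congrArg v hz
        rw [LinearMap.comp_apply, hv, hv, LinearMap.comp_apply, hgf, map_zero] at this
        exact this.symm

inductive RegId (R : Type) [CommRing R] : ℕ → Ideal R → Prop
  | zero : RegId R 0 ⊥
  | succ (n : ℕ) (J : Ideal R) (x : R) : RegId R n J → (∀ a, x * a ∈ J → a ∈ J) →
      RegId R (n + 1) (J ⊔ Ideal.span {x})

lemma red_quot {R : Type} [CommRing R] (x : R) (J : Ideal R) (hx : ∀ a, x * a ∈ J → a ∈ J)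
    (T : ∀ (M : Type) [AddCommGroup M] [Module R M], Prop) (hT : T (R ⧸ (J ⊔ Ideal.span {x}))) :
    Red x T (R ⧸ J) := by
  refine ⟨?_, R ⧸ (J ⊔ Ideal.span {x}), inferInstance, inferInstance,
    Submodule.factor le_sup_left, Submodule.factor_surjective _, ?_, hT⟩
  · intro m hm
    obtain ⟨a, rfl⟩ := Submodule.Quotient.mk_surjective _ m
    rw [← Submodule.Quotient.mk_smul, Submodule.Quotient.mk_eq_zero] at hm
    exact (Submodule.Quotient.mk_eq_zero _).2 (hx a hm)
  · intro m
    obtain ⟨a, rfl⟩ := Submodule.mkQ_surjective _ m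
    have : (Submodule.factor (le_sup_left : J ≤ J ⊔ Ideal.span {x})) (J.mkQ a) = 0 ↔
      a ∈ J ⊔ Ideal.span {x} := Submodule.Quotient.mk_eq_zero _
    rw [this, Submodule.mem_sup]
    constructor
    · rintro ⟨j, hj, z, hz, rfl⟩
      obtain ⟨b, rfl⟩ := Ideal.mem_span_singleton'.1 hz
      refine ⟨J.mkQ b, ?_⟩
      rw [← map_smul, ← sub_eq_zero, ← map_sub]
      refine (Submodule.Quotient.mk_eq_zero _).2 ?_
      have : x • b - (j + b * x) = -j := by rw [smul_eq_mul]; ring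
      rw [this]; exact J.neg_mem hj
    · rintro ⟨m', hm⟩
      obtain ⟨b, rfl⟩ := Submodule.mkQ_surjective _ m'
      rw [← map_smul, ← sub_eq_zero, ← map_sub] at hm
      have := (Submodule.Quotient.mk_eq_zero _).1 hm
      exact ⟨a - x * b, by simpa using J.neg_mem this, x * b,
        Ideal.mul_mem_right _ _ (Ideal.mem_span_singleton_self x), by ring⟩

lemma regId_ffr {R : Type} [CommRing R] (n : ℕ) (J : Ideal R) (h : RegId R n J) :
    FFR R n (R ⧸ J) := by
  induction h with
  | zero =>
    let e : (R ⧸ (⊥ : Ideal R)) ≃ₗ[R] R := Submodule.quotEquivOfEqBot _ rfl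
    exact ⟨Module.Free.of_equiv e.symm, Module.Finite.equiv e.symm⟩
  | succ n J x h hx ih =>
    obtain ⟨h1, N, _, _, g, hg, hgk, e⟩ := red_quot x J hx
      (fun M _ _ => Nonempty (M ≃ₗ[R] (R ⧸ (J ⊔ Ideal.span {x})))) ⟨LinearEquiv.refl _ _⟩
    obtain ⟨e⟩ := e
    refine ffr_cone R n (R ⧸ J) (R ⧸ J) _ (LinearMap.lsmul R (R ⧸ J) x) (e.toLinearMap ∘ₗ g)
      ?_ (e.surjective.comp hg) ?_ ih ih
    · rw [injective_iff_map_eq_zero]; exact h1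
    · intro y
      simp only [LinearMap.comp_apply, LinearEquiv.coe_coe, LinearEquiv.map_eq_zero_iff]
      exact hgk y

lemma pow_sup {R : Type} [CommRing R] (J : Ideal R) (x : R) (s : ℕ) (a : R)
    (ha : a ∈ (J ⊔ Ideal.span {x}) ^ (s + 1)) :
    ∃ j ∈ J ^ (s + 1), ∃ b ∈ (J ⊔ Ideal.span {x}) ^ s, a = j + x * b := by
  have : (J ⊔ Ideal.span {x}) ^ (s + 1) ≤
      J ^ (s + 1) ⊔ Ideal.span {x} * (J ⊔ Ideal.span {x}) ^ s := by
    clear ha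
    induction s with
    | zero => simp
    | succ s ih =>
      rw [pow_succ' _ (s + 1), Ideal.sup_mul]
      refine sup_le ?_ le_sup_right
      refine (Ideal.mul_mono_right ih).trans ?_
      rw [Ideal.mul_sup, ← pow_succ']
      refine sup_le_sup_left ?_ _
      rw [mul_left_comm]
      refine Ideal.mul_mono_right ?_
      rw [pow_succ']
      exact Ideal.mul_mono_left le_sup_left
  obtain ⟨j, hj, z, hz, rfl⟩ := Submodule.mem_sup.1 (this ha)
  obtain ⟨b, hb, rfl⟩ := Ideal.mem_span_singleton_mul.1 hz
  exact ⟨j, hj, b, hb, rfl⟩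

lemma regId_pow {R : Type} [CommRing R] (n : ℕ) (J : Ideal R) (h : RegId R n J) :
    ∀ (T : ∀ (M : Type) [AddCommGroup M] [Module R M], Prop), ExtCl R T → T (R ⧸ J) →
      ∀ s, T (R ⧸ (J ^ (s + 1))) := by
  induction h with
  | zero =>
    intro T hT h s
    have : (⊥ : Ideal R) ^ (s + 1) = ⊥ := by
      rw [pow_succ]; simp
    rw [this]; exact h
  | succ n J x h hx ih =>
    intro T hT hJ s
    have hred := ih (fun M _ _ => Red x T M) (red_ext x T hT) (red_quot x J hx T hJ)
    induction s with
    | zero => rw [zero_add, pow_one]; exact hJ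
    | succ s ihs =>
      obtain ⟨h1, N, _, _, g, hg, hgk, hN⟩ := hred (s + 1)
      set I := J ⊔ Ideal.span {x} with hI
      have hxI : x ∈ I := (le_sup_right : _ ≤ I) (Ideal.mem_span_singleton_self x)
      have hJI : J ≤ I := le_sup_left
      have hxr : ∀ a, x * a ∈ J ^ (s + 1 + 1) → a ∈ J ^ (s + 1 + 1) := by
        intro a ha
        refine (Submodule.Quotient.mk_eq_zero _).1 (h1 (Submodule.Quotient.mk a) ?_)
        rw [← Submodule.Quotient.mk_smul, Submodule.Quotient.mk_eq_zero]
        exact ha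
      have hgx : ∀ b, g (Submodule.mkQ _ (x * b)) = 0 := fun b =>
        (hgk _).2 ⟨Submodule.mkQ _ b, by rw [← map_smul]; rfl⟩
      have hgj : ∀ j ∈ J ^ (s + 1 + 1), g (Submodule.mkQ _ j) = 0 := fun j hj => by
        have : Submodule.mkQ (J ^ (s + 1 + 1)) j = 0 := (Submodule.Quotient.mk_eq_zero _).2 hj
        rw [this, map_zero]
      have hle : I ^ (s + 1 + 1) ≤ LinearMap.ker (g ∘ₗ (J ^ (s + 1 + 1)).mkQ) := by
        intro a ha
        obtain ⟨j, hj, b, hb, rfl⟩ := pow_sup J x (s + 1) a ha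
        rw [LinearMap.mem_ker, LinearMap.comp_apply, map_add, map_add, hgx, hgj j hj, add_zero]
      refine hT (R ⧸ I ^ (s + 1)) (R ⧸ I ^ (s + 1 + 1)) N
        (Submodule.mapQ _ _ (LinearMap.lsmul R R x) (fun a ha => ?_))
        (Submodule.liftQ _ (g ∘ₗ (J ^ (s + 1 + 1)).mkQ) hle) ?_ ?_ ?_ ihs hN
      · change x * a ∈ I ^ (s + 1 + 1)
        rw [pow_succ' _ (s + 1)]
        exact Ideal.mul_mem_mul hxI ha
      · rw [injective_iff_map_eq_zero]
        intro y hy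
        obtain ⟨a, rfl⟩ := Submodule.mkQ_surjective _ y
        have hy : x * a ∈ I ^ (s + 1 + 1) := (Submodule.Quotient.mk_eq_zero _).1 hy
        obtain ⟨j, hj, b, hb, hab⟩ := pow_sup J x (s + 1) _ hy
        have : a - b ∈ J ^ (s + 1 + 1) := hxr _ (by rw [mul_sub, hab]; simpa using hj)
        refine (Submodule.Quotient.mk_eq_zero _).2 ?_
        have h2 := Ideal.pow_le_pow_right (Nat.le_succ (s + 1)) (Ideal.pow_right_mono hJI _ this)
        simpa using Ideal.add_mem _ h2 hb
      · intro y
        obtain ⟨y, rfl⟩ := hg y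
        obtain ⟨a, rfl⟩ := Submodule.mkQ_surjective _ y
        exact ⟨Submodule.mkQ _ a, rfl⟩
      · intro y
        obtain ⟨a, rfl⟩ := Submodule.mkQ_surjective _ y
        change g (Submodule.mkQ _ a) = 0 ↔ _
        constructor
        · intro h
          obtain ⟨m, hm⟩ := (hgk _).1 h
          obtain ⟨b, rfl⟩ := Submodule.mkQ_surjective _ m
          refine ⟨Submodule.mkQ _ b, ?_⟩
          rw [← map_smul, ← sub_eq_zero, ← map_sub] at hm
          have hm := (Submodule.Quotient.mk_eq_zero _).1 hm
          change Submodule.mkQ _ (x • b) = _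
          rw [← sub_eq_zero, ← map_sub]
          exact (Submodule.Quotient.mk_eq_zero _).2 (Ideal.pow_right_mono hJI _ hm)
        · rintro ⟨m, hm⟩
          obtain ⟨b, rfl⟩ := Submodule.mkQ_surjective _ m
          change Submodule.mkQ _ (x • b) = _ at hm
          rw [← sub_eq_zero, ← map_sub] at hm
          have hm := hle ((Submodule.Quotient.mk_eq_zero _).1 hm)
          rw [LinearMap.mem_ker, LinearMap.comp_apply, map_sub, map_sub, smul_eq_mul, hgx,
            zero_sub, neg_eq_zero] at hm
          exact hm

universe u

lemma ffr_complex (R : Type) [CommRing R] (n : ℕ) : ∀ (M : Type) [AddCommGroup M] [Module R M],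
    FFR R n M → ∃ (F : ℕ → ModuleCat.{u} R) (d : ∀ i : ℕ, F (i + 1) →ₗ[R] F i)
      (ε : F 0 →ₗ[R] M),
      (∀ i, Module.Free R (F i)) ∧
      (∀ i, Module.Finite R (F i)) ∧
      (∀ i, n < i → Subsingleton (F i)) ∧
      Function.Surjective ε ∧
      Function.Exact (d 0) ε ∧
      (∀ i, Function.Exact (d (i + 1)) (d i)) := by
  induction n with
  | zero =>
    rintro M _ _ ⟨h1, h2⟩
    let F : ℕ → ModuleCat.{u} R := fun i => match i with
      | 0 => ModuleCat.of R (ULift.{u} M)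
      | _ + 1 => ModuleCat.of R PUnit.{u + 1}
    have hs : ∀ i, Subsingleton (F (i + 1)) := fun i =>
      inferInstanceAs (Subsingleton PUnit.{u + 1})
    refine ⟨F, fun i => 0, (ULift.moduleEquiv : ULift.{u} M ≃ₗ[R] M).toLinearMap,
      ?_, ?_, ?_, ?_, ?_, ?_⟩
    · rintro (_ | i)
      · exact inferInstanceAs (Module.Free R (ULift.{u} M))
      · exact inferInstanceAs (Module.Free R PUnit.{u + 1})
    · rintro (_ | i)
      · exact inferInstanceAs (Module.Finite R (ULift.{u} M))
      · exact inferInstanceAs (Module.Finite R PUnit.{u + 1})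
    · rintro (_ | i) hi
      · omega
      · exact hs i
    · exact (ULift.moduleEquiv : ULift.{u} M ≃ₗ[R] M).surjective
    · intro y
      constructor
      · intro h
        exact ⟨0, ((ULift.moduleEquiv : ULift.{u} M ≃ₗ[R] M).map_eq_zero_iff.1 h).symm⟩
      · rintro ⟨z, rfl⟩
        exact map_zero (ULift.moduleEquiv : ULift.{u} M ≃ₗ[R] M)
    · intro i y
      exact ⟨fun _ => ⟨0, (hs i).elim _ _⟩, fun _ => rfl⟩
  | succ n ih =>
    rintro M _ _ ⟨P, _, _, f, h1, h2, h3, h4⟩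
    obtain ⟨F, d, ε, a1, a2, a3, a4, a5, a6⟩ := ih _ h4
    let e : ULift.{u} P ≃ₗ[R] P := ULift.moduleEquiv
    let F' : ℕ → ModuleCat.{u} R := fun i => match i with
      | 0 => ModuleCat.of R (ULift.{u} P)
      | i + 1 => F i
    let d0 : F 0 →ₗ[R] ULift.{u} P := e.symm.toLinearMap ∘ₗ (LinearMap.ker f).subtype ∘ₗ ε
    let d' : ∀ i : ℕ, F' (i + 1) →ₗ[R] F' i := fun i => match i with
      | 0 => d0
      | i + 1 => d i
    have hd0 : ∀ y, d0 y = 0 ↔ ε y = 0 := fun y => by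
      simp [d0]
    refine ⟨F', d', f ∘ₗ e.toLinearMap, ?_, ?_, ?_, ?_, ?_, ?_⟩
    · rintro (_ | i)
      · exact inferInstanceAs (Module.Free R (ULift.{u} P))
      · exact a1 i
    · rintro (_ | i)
      · exact inferInstanceAs (Module.Finite R (ULift.{u} P))
      · exact a2 i
    · rintro (_ | i) hi
      · omega
      · exact a3 i (by omega)
    · exact h3.comp e.surjective
    · intro y
      constructor
      · intro h
        obtain ⟨z, hz⟩ := a4 ⟨e y, h⟩
        refine ⟨z, ?_⟩
        change e.symm (ε z).1 = y
        rw [hz]; exact e.symm_apply_apply y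
      · rintro ⟨z, rfl⟩
        change f (e (e.symm (ε z).1)) = 0
        rw [e.apply_symm_apply]; exact (ε z).2
    · rintro (_ | i)
      · intro y
        exact (hd0 y).trans (a5 y)
      · exact a6 i

lemma regId_ofList {R : Type} [CommRing R] (l : List R)
    (h : RingTheory.Sequence.IsWeaklyRegular R l) (i : ℕ) (hi : i ≤ l.length) :
    RegId R i (Ideal.ofList (l.take i)) := by
  induction i with
  | zero => simpa using RegId.zero
  | succ i ih =>
    have hi' : i < l.length := hi
    rw [List.take_succ_eq_append_getElem hi', Ideal.ofList_append, Ideal.ofList_singleton]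
    refine RegId.succ i _ _ (ih hi'.le) fun a ha => ?_
    have := h.regular_mod_prev i hi'
    have e : Ideal.ofList (l.take i) • (⊤ : Submodule R R) = Ideal.ofList (l.take i) :=
      Ideal.mul_top _
    rw [e] at this
    refine (Submodule.Quotient.mk_eq_zero _).1 (this ?_)
    change l[i] • Submodule.Quotient.mk a = l[i] • (0 : R ⧸ _)
    rw [smul_zero, ← Submodule.Quotient.mk_smul, Submodule.Quotient.mk_eq_zero]
    exact ha

/-- Let `r : Fin n → R` be a regular sequence generating the ideal `I`.
For every `s ≥ 1`, the `R`-module `R/I^s` admits a free resolution of length `n` by finitely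
generated free `R`-modules (in particular, its projective dimension is at most `n`). -/
theorem stmt_0 (R : Type) [CommRing R] {n : ℕ} (r : Fin n → R)
    (hreg : RingTheory.Sequence.IsRegular R (List.ofFn r))
    (I : Ideal R) (hI : I = Ideal.span (Set.range r)) (s : ℕ) (hs : 1 ≤ s) :
    ∃ (F : ℕ → ModuleCat R) (d : ∀ i : ℕ, F (i + 1) →ₗ[R] F i)
      (ε : F 0 →ₗ[R] (R ⧸ (I ^ s))),
      (∀ i, Module.Free R (F i)) ∧
      (∀ i, Module.Finite R (F i)) ∧
      (∀ i, n < i → Subsingleton (F i)) ∧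
      Function.Surjective ε ∧
      Function.Exact (d 0) ε ∧
      (∀ i, Function.Exact (d (i + 1)) (d i)) := by
  have h : RegId R n I := by
    have := regId_ofList _ hreg.toIsWeaklyRegular n (by simp)
    rw [List.take_of_length_le (by simp)] at this
    convert this
    rw [hI, Ideal.ofList]
    congr 1
    ext x
    simp [List.mem_ofFn]
  obtain ⟨s, rfl⟩ : ∃ t, s = t + 1 := ⟨s - 1, by omega⟩
  exact ffr_complex R n _ (regId_pow n I h _ (ffr_ext R n) (regId_ffr n I h) s)
end

section
/- For every integer s ≥ 1, the R-module I^s admits a free resolution of length n by free R-modules; in particular, I^s has projective dimension at most n as an R-module. -/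
open CategoryTheory

def FDim (R : Type) [CommRing R] : ℕ → (M : Type) → [AddCommGroup M] → [Module R M] → Prop
  | 0, M, _, _ => Module.Free R M
  | n + 1, M, _, _ => ∃ (F : Type) (_ : AddCommGroup F) (_ : Module R F) (f : F →ₗ[R] M),
      Module.Free R F ∧ Function.Surjective f ∧ FDim R n (LinearMap.ker f)

section
variable {R : Type} [CommRing R]

theorem FDim.congr {n : ℕ} {M N : Type} [AddCommGroup M] [Module R M] [AddCommGroup N] [Module R N]
    (h : FDim R n M) (e : M ≃ₗ[R] N) : FDim R n N := by
  cases n with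
  | zero =>
    have : Module.Free R M := h
    exact Module.Free.of_equiv e
  | succ n =>
    obtain ⟨F, _, _, f, hF, hf, hk⟩ := h
    refine ⟨F, _, _, e.toLinearMap ∘ₗ f, hF, e.surjective.comp hf, ?_⟩
    rwa [LinearEquiv.ker_comp]

theorem FDim.of_subsingleton {M : Type} [AddCommGroup M] [Module R M] [Subsingleton M] (n : ℕ) :
    FDim R n M := by
  induction n generalizing M with
  | zero => exact Module.Free.of_subsingleton R M
  | succ n ih =>
    exact ⟨M, _, _, LinearMap.id, Module.Free.of_subsingleton R M, Function.surjective_id, ih⟩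

theorem FDim.succ {n : ℕ} {M : Type} [AddCommGroup M] [Module R M]
    (h : FDim R n M) : FDim R (n + 1) M := by
  induction n generalizing M with
  | zero =>
    refine ⟨M, _, _, LinearMap.id, h, Function.surjective_id, ?_⟩
    rw [LinearMap.ker_id]
    exact FDim.of_subsingleton 0
  | succ n ih =>
    obtain ⟨F, _, _, f, hF, hf, hk⟩ := h
    exact ⟨F, _, _, f, hF, hf, ih hk⟩

theorem FDim.of_free {M : Type} [AddCommGroup M] [Module R M] (h : Module.Free R M) (n : ℕ) :
    FDim R n M := by
  induction n with
  | zero => exact h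
  | succ n ih => exact ih.succ

theorem FDim.ext {n : ℕ} {A B C : Type} [AddCommGroup A] [Module R A] [AddCommGroup B] [Module R B]
    [AddCommGroup C] [Module R C] (i : A →ₗ[R] B) (p : B →ₗ[R] C)
    (hi : Function.Injective i) (hip : Function.Exact i p) (hp : Function.Surjective p)
    (hA : FDim R n A) (hC : FDim R n C) : FDim R n B := by
  induction n generalizing A B C with
  | zero =>
    have : Module.Free R A := hA
    have : Module.Free R C := hC
    obtain ⟨l, hl⟩ := Module.projective_lifting_property p LinearMap.id hp
    have e := (hip.splitSurjectiveEquiv hi ⟨l, hl⟩).1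
    exact Module.Free.of_equiv e.symm
  | succ n ih =>
    obtain ⟨F, _, _, f, hF, hf, hk⟩ := hA
    obtain ⟨G, _, _, g, hG, hg, hl⟩ := hC
    obtain ⟨l, hl'⟩ := Module.projective_lifting_property p g hp
    have hlx : ∀ x, p (l x) = g x := fun x => LinearMap.congr_fun hl' x
    have hpi : ∀ a, p (i a) = 0 := fun a => hip.apply_apply_eq_zero a
    refine ⟨F × G, _, _, (i ∘ₗ f).coprod l, inferInstance, ?_, ?_⟩
    · intro b
      obtain ⟨y, hy⟩ := hg (p b)
      obtain ⟨a, ha⟩ := (hip (b - l y)).1 (by rw [map_sub, hlx, hy, sub_self])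
      obtain ⟨x, hx⟩ := hf a
      exact ⟨(x, y), by simp [hx, ha]⟩
    · let j : LinearMap.ker f →ₗ[R] LinearMap.ker ((i ∘ₗ f).coprod l) :=
        LinearMap.codRestrict _ (LinearMap.inl R F G ∘ₗ (LinearMap.ker f).subtype) (by
          rintro ⟨x, hx⟩
          have hx : f x = 0 := hx
          simp [hx])
      let q : LinearMap.ker ((i ∘ₗ f).coprod l) →ₗ[R] LinearMap.ker g :=
        LinearMap.codRestrict _ (LinearMap.snd R F G ∘ₗ (LinearMap.ker _).subtype) (by
          rintro ⟨⟨x, y⟩, hx⟩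
          have hx : i (f x) + l y = 0 := by simpa using hx
          have := congrArg p hx
          rw [map_add, hpi, hlx] at this
          simpa using this)
      refine ih j q ?_ ?_ ?_ hk hl
      · rintro ⟨x, hx⟩ ⟨y, hy⟩ h
        have := congrArg (fun z => z.1.1) h
        exact Subtype.ext this
      · rintro ⟨⟨x, y⟩, hx⟩
        have hx' : i (f x) + l y = 0 := by simpa using hx
        constructor
        · intro h
          have hy : y = 0 := congrArg Subtype.val h
          subst hy
          have : f x = 0 := hi (by simpa using hx')
          exact ⟨⟨x, this⟩, rfl⟩
        · rintro ⟨⟨z, hz⟩, h⟩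
          have hy : 0 = y := congrArg (fun z => z.1.2) h
          exact Subtype.ext hy.symm
      · rintro ⟨y, hy⟩
        have hy' : g y = 0 := hy
        obtain ⟨a, ha⟩ := (hip (- l y)).1 (by rw [map_neg, hlx, hy', neg_zero])
        obtain ⟨x, hx⟩ := hf a
        exact ⟨⟨(x, y), by simp [hx, ha]⟩, rfl⟩

theorem FDim.cone {n : ℕ} {A B C : Type} [AddCommGroup A] [Module R A] [AddCommGroup B] [Module R B]
    [AddCommGroup C] [Module R C] (i : A →ₗ[R] B) (p : B →ₗ[R] C)
    (hi : Function.Injective i) (hip : Function.Exact i p) (hp : Function.Surjective p)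
    (hA : FDim R n A) (hB : FDim R (n + 1) B) : FDim R (n + 1) C := by
  obtain ⟨F, _, _, f, hF, hf, hk⟩ := hB
  refine ⟨F, _, _, p ∘ₗ f, hF, hp.comp hf, ?_⟩
  let e := LinearEquiv.ofInjective i hi
  have hr : ∀ x : LinearMap.ker (p ∘ₗ f), (f ∘ₗ (LinearMap.ker (p ∘ₗ f)).subtype) x ∈
      LinearMap.range i := by
    rintro ⟨x, hx⟩
    exact (hip (f x)).1 hx
  let q : LinearMap.ker (p ∘ₗ f) →ₗ[R] LinearMap.range i :=
    LinearMap.codRestrict _ (f ∘ₗ (LinearMap.ker (p ∘ₗ f)).subtype) hr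
  let j : LinearMap.ker f →ₗ[R] LinearMap.ker (p ∘ₗ f) :=
    Submodule.inclusion (LinearMap.ker_le_ker_comp f p)
  refine FDim.ext j q (Submodule.inclusion_injective _) ?_ ?_ hk (hA.congr e)
  · rintro ⟨x, hx⟩
    constructor
    · intro h
      have h : f x = 0 := congrArg Subtype.val h
      exact ⟨⟨x, h⟩, rfl⟩
    · rintro ⟨⟨z, hz⟩, h⟩
      have h : z = x := congrArg Subtype.val h
      subst h
      exact Subtype.ext hz
  · rintro ⟨_, ⟨a, rfl⟩⟩
    obtain ⟨x, hx⟩ := hf (i a)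
    exact ⟨⟨x, by simp [hx, hip.apply_apply_eq_zero]⟩, Subtype.ext hx⟩

theorem FDim.resolution.{v} {n : ℕ} {M : Type} [AddCommGroup M] [Module R M] (h : FDim R n M) :
    ∃ (F : ℕ → ModuleCat.{v} R) (d : ∀ i : ℕ, F (i + 1) →ₗ[R] F i)
      (ε : F 0 →ₗ[R] M),
      (∀ i, Module.Free R (F i)) ∧
      (∀ i, n < i → Subsingleton (F i)) ∧
      Function.Surjective ε ∧
      Function.Exact (d 0) ε ∧
      (∀ i, Function.Exact (d (i + 1)) (d i)) := by
  induction n generalizing M with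
  | zero =>
    have hM : Module.Free R M := h
    refine ⟨fun i => Nat.casesOn i (ModuleCat.of R (ULift M)) (fun _ => ModuleCat.of R PUnit),
      fun i => 0, (ULift.moduleEquiv : ULift.{v} M ≃ₗ[R] M).toLinearMap, ?_, ?_, ?_, ?_, ?_⟩
    · rintro (_ | i)
      · exact inferInstanceAs (Module.Free R (ULift M))
      · exact Module.Free.of_subsingleton R PUnit.{v+1}
    · rintro (_ | i) hi
      · omega
      · exact inferInstanceAs (Subsingleton PUnit.{v+1})
    · exact (ULift.moduleEquiv : ULift.{v} M ≃ₗ[R] M).surjective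
    · intro x
      constructor
      · intro hx
        exact ⟨0, ((ULift.moduleEquiv : ULift.{v} M ≃ₗ[R] M).map_eq_zero_iff.1 hx).symm⟩
      · rintro ⟨y, rfl⟩
        exact map_zero (ULift.moduleEquiv : ULift.{v} M ≃ₗ[R] M)
    · intro i x
      exact ⟨fun _ => ⟨PUnit.unit, rfl⟩, fun _ => rfl⟩
  | succ n ih =>
    obtain ⟨G, _, _, f, hG, hf, hk⟩ := h
    obtain ⟨F, d, ε, hF, hs, hε, h0, hd⟩ := ih hk
    let e : ULift.{v} G ≃ₗ[R] G := ULift.moduleEquiv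
    refine ⟨fun i => Nat.casesOn i (ModuleCat.of R (ULift.{v} G)) F,
      fun i => Nat.casesOn i (e.symm.toLinearMap ∘ₗ (LinearMap.ker f).subtype ∘ₗ ε) d,
      f ∘ₗ e.toLinearMap, ?_, ?_, ?_, ?_, ?_⟩
    · rintro (_ | i)
      · exact inferInstanceAs (Module.Free R (ULift G))
      · exact hF i
    · rintro (_ | i) hi
      · omega
      · exact hs i (by omega)
    · exact hf.comp e.surjective
    · intro x
      constructor
      · intro hx
        obtain ⟨y, hy⟩ := hε ⟨e x, hx⟩
        refine ⟨y, ?_⟩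
        change e.symm (ε y).1 = x
        rw [hy]
        exact e.symm_apply_apply x
      · rintro ⟨y, rfl⟩
        exact (ε y).2
    · rintro (_ | i)
      · intro x
        rw [← h0 x]
        change e.symm (ε x).1 = 0 ↔ _
        rw [LinearEquiv.map_eq_zero_iff, Submodule.coe_eq_zero]
      · exact hd i

/-- quasi-regularity type property -/
def QReg (J : Ideal R) : Prop :=
  ∀ (K : Ideal R), J ≤ K → ∀ y : R, (∀ b, y * b ∈ K → b ∈ K) →
    ∀ s : ℕ, ∀ b ∈ J ^ s, y * b ∈ K * J ^ s → b ∈ K * J ^ s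

theorem QReg.pow {J : Ideal R} (h : QReg J) {y : R} (hy : ∀ b, y * b ∈ J → b ∈ J) (s : ℕ) (b : R)
    (hb : y * b ∈ J ^ s) : b ∈ J ^ s := by
  induction s with
  | zero => simp
  | succ s ih =>
    rw [pow_succ'] at hb ⊢
    have hle : J * J ^ s ≤ J ^ s := Ideal.mul_le_right
    exact h J le_rfl y hy s b (ih (hle hb)) hb

theorem pow_sup_span (J : Ideal R) (x : R) (s : ℕ) :
    (J ⊔ Ideal.span {x}) ^ (s + 1) = J ^ (s + 1) ⊔ Ideal.span {x} * (J ⊔ Ideal.span {x}) ^ s := by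
  apply le_antisymm
  · induction s with
    | zero => simp
    | succ s ih =>
      rw [pow_succ' _ (s + 1)]
      rw [Ideal.sup_mul]
      refine sup_le ?_ le_sup_right
      refine (Ideal.mul_mono_right ih).trans ?_
      rw [Ideal.mul_sup, ← pow_succ']
      refine sup_le_sup le_rfl ?_
      rw [mul_left_comm, pow_succ']
      exact Ideal.mul_mono_right (Ideal.mul_mono_left le_sup_left)
  · refine sup_le (Ideal.pow_right_mono le_sup_left _) ?_
    rw [pow_succ']
    exact Ideal.mul_mono_left le_sup_right

theorem QReg.bot : QReg (⊥ : Ideal R) := by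
  intro K hK y hy s b hb hyb
  cases s with
  | zero => simpa using hy b (by simpa using hyb)
  | succ s =>
    have : b = 0 := by simpa [pow_succ] using hb
    simp [this]

theorem QReg.sup {J : Ideal R} (h : QReg J) {x : R} (hx : ∀ b, x * b ∈ J → b ∈ J) :
    QReg (J ⊔ Ideal.span {x}) := by
  intro K hK y hy s
  have hJK : J ≤ K := le_sup_left.trans hK
  have hxK : x ∈ K := hK (Ideal.mem_sup_right (Ideal.mem_span_singleton_self x))
  induction s with
  | zero => intro b _ hb; simpa using hy b (by simpa using hb)
  | succ s ih =>
    intro b hb hyb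
    have hle : K * J ^ (s + 1) ≤ J ^ (s + 1) := Ideal.mul_le_right
    set I := J ⊔ Ideal.span {x} with hI
    have hmem : ∀ z ∈ J ^ (s + 1), z ∈ K * I ^ s := by
      intro z hz
      rw [pow_succ'] at hz
      exact Ideal.mul_mono hJK (Ideal.pow_right_mono le_sup_left _) hz
    rw [hI, pow_sup_span, ← hI] at hb hyb ⊢
    rw [Ideal.mul_sup, mul_left_comm] at hyb ⊢
    obtain ⟨a, ha, c', hc', rfl⟩ := Submodule.mem_sup.1 hb
    obtain ⟨c, hc, rfl⟩ := Ideal.mem_span_singleton_mul.1 hc'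
    obtain ⟨a', ha', c'', hc'', heq⟩ := Submodule.mem_sup.1 hyb
    obtain ⟨c', hcc, rfl⟩ := Ideal.mem_span_singleton_mul.1 hc''
    have h1 : y * c - c' ∈ J ^ (s + 1) := by
      apply h.pow hx
      have : x * (y * c - c') = a' - y * a := by linear_combination -heq
      rw [this]
      exact sub_mem (hle ha') (Ideal.mul_mem_left _ _ ha)
    have h2 : y * c ∈ K * I ^ s := by
      have := add_mem (hmem _ h1) hcc
      simpa using this
    have h3 : y * a ∈ K * J ^ (s + 1) := by
      have : y * a = a' - x * (y * c - c') := by linear_combination -heq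
      rw [this]
      exact sub_mem ha' (Ideal.mul_mem_mul hxK h1)
    exact add_mem (Ideal.mem_sup_left (h K hJK y hy _ a ha h3))
      (Ideal.mem_sup_right (Ideal.mul_mem_mul (Ideal.mem_span_singleton_self x) (ih c hc h2)))

theorem FDim.pow_sup {J : Ideal R} (h : QReg J) {x : R} (hx : ∀ b, x * b ∈ J → b ∈ J) {n : ℕ}
    (hJ : ∀ s, FDim R n ↥(J ^ s)) (s : ℕ) : FDim R (n + 1) ↥((J ⊔ Ideal.span {x}) ^ s) := by
  induction s with
  | zero =>
    rw [pow_zero, Ideal.one_eq_top]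
    exact (FDim.of_free (Module.Free.self R) _).congr Submodule.topEquiv.symm
  | succ s ih =>
    set I := J ⊔ Ideal.span {x} with hI
    have hJI : J ^ (s + 1) ≤ I ^ (s + 1) := Ideal.pow_right_mono le_sup_left _
    have hJI' : J ^ (s + 1) ≤ I ^ s := hJI.trans (Ideal.pow_le_pow_right (Nat.le_succ s))
    have hB : FDim R (n + 1) (↥(J ^ (s + 1)) × ↥(I ^ s)) :=
      FDim.ext (LinearMap.inl R _ _) (LinearMap.snd R _ _) LinearMap.inl_injective
        Function.Exact.inl_snd LinearMap.snd_surjective (hJ _).succ ih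
    have hxI : x ∈ I := Ideal.mem_sup_right (Ideal.mem_span_singleton_self x)
    let i : ↥(J ^ (s + 1)) →ₗ[R] ↥(J ^ (s + 1)) × ↥(I ^ s) :=
      (x • LinearMap.id).prod (-(Submodule.inclusion hJI'))
    let m : ↥(I ^ s) →ₗ[R] ↥(I ^ (s + 1)) :=
      LinearMap.codRestrict _ (x • (I ^ s).subtype) (by
        intro c
        rw [pow_succ']
        exact Ideal.mul_mem_mul hxI c.2)
    let p : ↥(J ^ (s + 1)) × ↥(I ^ s) →ₗ[R] ↥(I ^ (s + 1)) :=
      (Submodule.inclusion hJI).coprod m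
    have hpv : ∀ a c, (p (a, c)).1 = a.1 + x * c.1 := fun a c => rfl
    have hi1 : ∀ a, (i a).1.1 = x * a.1 := fun a => rfl
    have hi2 : ∀ a, (i a).2.1 = - a.1 := fun a => rfl
    refine FDim.cone i p ?_ ?_ ?_ (hJ (s + 1)) hB
    · intro a b hab
      have := congrArg (fun z => z.2.1) hab
      simp only [hi2] at this
      exact Subtype.ext (neg_injective this)
    · rintro ⟨a, c⟩
      rw [← Submodule.coe_eq_zero, hpv]
      constructor
      · intro h0
        have hc : c.1 ∈ J ^ (s + 1) := h.pow hx _ _ (by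
          rw [show x * c.1 = - a.1 by linear_combination h0]
          exact neg_mem a.2)
        refine ⟨-⟨c.1, hc⟩, Prod.ext (Subtype.ext ?_) (Subtype.ext ?_)⟩
        · rw [hi1]
          change x * (-c.1) = a.1
          linear_combination - h0
        · rw [hi2]
          change - (-c.1) = c.1
          exact neg_neg _
      · rintro ⟨b, hb⟩
        have h1 := congrArg (fun z => z.1.1) hb
        have h2 := congrArg (fun z => z.2.1) hb
        simp only [hi1, hi2] at h1 h2
        rw [← h1, ← h2]; ring
    · rintro ⟨b, hb⟩
      have hb' := hb
      rw [hI, pow_sup_span, ← hI] at hb'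
      obtain ⟨a, ha, c', hc', rfl⟩ := Submodule.mem_sup.1 hb'
      obtain ⟨c, hc, rfl⟩ := Ideal.mem_span_singleton_mul.1 hc'
      exact ⟨(⟨a, ha⟩, ⟨c, hc⟩), Subtype.ext rfl⟩

theorem regular_list (rs : List R) (h : RingTheory.Sequence.IsWeaklyRegular R rs) :
    QReg (Ideal.ofList rs) ∧ ∀ s, FDim R rs.length ↥(Ideal.ofList rs ^ s) := by
  induction rs using List.reverseRecOn with
  | nil =>
    rw [Ideal.ofList_nil]
    refine ⟨QReg.bot, fun s => ?_⟩
    cases s with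
    | zero =>
      rw [pow_zero, Ideal.one_eq_top]
      exact (FDim.of_free (Module.Free.self R) _).congr Submodule.topEquiv.symm
    | succ s =>
      have : (⊥ : Ideal R) ^ (s + 1) = ⊥ := by rw [pow_succ, Ideal.mul_bot]
      rw [this]
      exact FDim.of_subsingleton _
  | append_singleton rs x ih =>
    rw [RingTheory.Sequence.isWeaklyRegular_append_iff,
      RingTheory.Sequence.isWeaklyRegular_singleton_iff,
      isSMulRegular_quotient_iff_mem_of_smul_mem] at h
    obtain ⟨hq, hd⟩ := ih h.1
    have hx : ∀ b, x * b ∈ Ideal.ofList rs → b ∈ Ideal.ofList rs := by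
      intro b hb
      have := h.2 b
      rw [smul_eq_mul, smul_eq_mul, Ideal.mul_top] at this
      exact this hb
    rw [Ideal.ofList_append, Ideal.ofList_singleton, List.length_append, List.length_singleton]
    exact ⟨hq.sup hx, FDim.pow_sup hq hx hd⟩
end

/-- Let `r : Fin n → R` be a regular sequence generating the ideal `I`.
For every `s ≥ 1`, the `R`-module `I^s` admits a free resolution of length `n` by free
`R`-modules (in particular, its projective dimension is at most `n`). -/
theorem stmt_1 (R : Type) [CommRing R] {n : ℕ} (r : Fin n → R)
    (hreg : RingTheory.Sequence.IsRegular R (List.ofFn r))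
    (I : Ideal R) (hI : I = Ideal.span (Set.range r)) (s : ℕ) (hs : 1 ≤ s) :
    ∃ (F : ℕ → ModuleCat R) (d : ∀ i : ℕ, F (i + 1) →ₗ[R] F i)
      (ε : F 0 →ₗ[R] ↥(I ^ s)),
      (∀ i, Module.Free R (F i)) ∧
      (∀ i, n < i → Subsingleton (F i)) ∧
      Function.Surjective ε ∧
      Function.Exact (d 0) ε ∧
      (∀ i, Function.Exact (d (i + 1)) (d i)) := by
  have h := (regular_list _ hreg.toIsWeaklyRegular).2 s
  have hI' : Ideal.ofList (List.ofFn r) = I := by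
    rw [hI]
    refine congrArg Ideal.span (Set.ext fun x => ?_)
    exact List.mem_ofFn
  rw [List.length_ofFn, hI'] at h
  exact h.resolution
end

section
/- For all integers s ≥ 1 and k ≥ 0, the R/I-module Tor_k^R(R/I, R/I^s) is free. -/
open CategoryTheory

noncomputable section

/-- The functor `Tor_k^R(R/I, -)` on `R`-modules. -/
def TorF (R : Type) [CommRing R] (I : Ideal R) (k : ℕ) :
    ModuleCat R ⥤ ModuleCat R :=
  (Tor (ModuleCat R) k).obj (ModuleCat.of R (R ⧸ I))

end


inductive RegIdeal {R : Type} [CommRing R] : Ideal R → Prop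
  | bot : RegIdeal ⊥
  | step (J : Ideal R) (y : R) (hJ : RegIdeal J) (hy : ∀ b, y * b ∈ J → b ∈ J) :
      RegIdeal (J ⊔ Ideal.span {y})

lemma sup_pow_succ {R : Type} [CommRing R] (J : Ideal R) (y : R) (s : ℕ) :
    (J ⊔ Ideal.span {y}) ^ (s + 1) =
      J ^ (s + 1) ⊔ Ideal.span {y} * (J ⊔ Ideal.span {y}) ^ s := by
  induction s with
  | zero => simp
  | succ s ih =>
    apply le_antisymm
    · rw [pow_succ' _ (s + 1), Ideal.sup_mul]
      apply sup_le
      · conv_lhs => rw [ih]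
        rw [Ideal.mul_sup]
        apply sup_le
        · rw [← pow_succ']; exact le_sup_left
        · rw [mul_left_comm, pow_succ' _ s]
          exact le_sup_of_le_right (Ideal.mul_mono_right (Ideal.mul_mono_left le_sup_left))
      · exact le_sup_right
    · apply sup_le
      · exact Ideal.pow_right_mono le_sup_left _
      · rw [pow_succ' _ (s + 1)]
        exact Ideal.mul_mono_left le_sup_right

lemma reg_pow {R : Type} [CommRing R] (J : Ideal R)
    (h : ∀ (s : ℕ) (K : Ideal R), J ≤ K → ∀ x : R, (∀ b, x * b ∈ K → b ∈ K) →
      ∀ b ∈ J ^ s, x * b ∈ K * J ^ s → b ∈ K * J ^ s)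
    (x : R) (hx : ∀ b, x * b ∈ J → b ∈ J) (s : ℕ) : ∀ b, x * b ∈ J ^ s → b ∈ J ^ s := by
  induction s with
  | zero => simp
  | succ s ih =>
    intro b hb
    rw [pow_succ'] at hb ⊢
    exact h s J le_rfl x hx b (ih b (Ideal.mul_le_right (I := J) (J := J ^ s) hb)) hb

lemma RegIdeal.key {R : Type} [CommRing R] {J : Ideal R} (hJ : RegIdeal J) :
    ∀ (s : ℕ) (K : Ideal R), J ≤ K → ∀ x : R, (∀ b, x * b ∈ K → b ∈ K) →
      ∀ b ∈ J ^ s, x * b ∈ K * J ^ s → b ∈ K * J ^ s := by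
  induction hJ with
  | bot =>
    intro s K hK x hx b hb hxb
    cases s with
    | zero => simpa using hx b (by simpa using hxb)
    | succ s =>
      have : b = 0 := by simpa [pow_succ] using hb
      simp [this]
  | step J' y hJ' hy ih =>
    intro s
    induction s with
    | zero =>
      intro K hK x hx b hb hxb
      simpa using hx b (by simpa using hxb)
    | succ s ihs =>
      intro K hK x hx b hb hxb
      have hKe : K * (J' ⊔ Ideal.span {y}) ^ (s + 1) =
          K * J' ^ (s + 1) ⊔ Ideal.span {y} * (K * (J' ⊔ Ideal.span {y}) ^ s) := by
        rw [sup_pow_succ, Ideal.mul_sup, mul_left_comm]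
      rw [sup_pow_succ] at hb
      rw [hKe] at hxb ⊢
      obtain ⟨a, ha, t, ht, rfl⟩ := Submodule.mem_sup.1 hb
      obtain ⟨c, hc, rfl⟩ := Ideal.mem_span_singleton_mul.1 ht
      obtain ⟨a', ha', t', ht', hE⟩ := Submodule.mem_sup.1 hxb
      obtain ⟨c', hc', rfl⟩ := Ideal.mem_span_singleton_mul.1 ht'
      have hJK : J' ≤ K := le_sup_left.trans hK
      have hyK : y ∈ K := hK (Ideal.mem_sup_right (Ideal.mem_span_singleton_self y))
      have h1 : x * c - c' ∈ J' ^ (s + 1) := by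
        apply reg_pow J' ih y hy
        have : y * (x * c - c') = a' - x * a := by linear_combination -hE
        rw [this]
        exact sub_mem (Ideal.mul_le_right (I := K) (J := J' ^ (s + 1)) ha') (Ideal.mul_mem_left _ _ ha)
      have h2 : x * c ∈ K * (J' ⊔ Ideal.span {y}) ^ s := by
        have h3 : x * c - c' ∈ K * (J' ⊔ Ideal.span {y}) ^ s := by
          rw [pow_succ'] at h1
          exact Ideal.mul_mono hJK (Ideal.pow_right_mono le_sup_left _) h1
        simpa using add_mem h3 hc'
      have h4 := ihs K hK x hx c hc h2
      refine Submodule.add_mem_sup ?_ (Ideal.mem_span_singleton_mul.2 ⟨c, h4, rfl⟩)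
      apply ih (s + 1) K hJK x hx a ha
      have : x * a = a' - y * (x * c - c') := by linear_combination -hE
      rw [this]
      exact sub_mem ha' (Ideal.mul_mem_mul hyK h1)

lemma regIdeal_of {R : Type} [CommRing R] (l : List R)
    (h : RingTheory.Sequence.IsWeaklyRegular R l) : RegIdeal (Ideal.ofList l) := by
  induction l using List.reverseRecOn with
  | nil => simpa using RegIdeal.bot
  | append_singleton l y ih =>
    rw [RingTheory.Sequence.isWeaklyRegular_append_iff] at h
    rw [Ideal.ofList_append, Ideal.ofList_singleton]
    refine RegIdeal.step _ _ (ih h.1) ?_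
    have h2 := (RingTheory.Sequence.isWeaklyRegular_singleton_iff _ _).1 h.2
    intro b hb
    rw [isSMulRegular_iff_right_eq_zero_of_smul] at h2
    have := h2 (Submodule.Quotient.mk b) (by
      rw [← Submodule.Quotient.mk_smul, Submodule.Quotient.mk_eq_zero]
      simpa using hb)
    rw [Submodule.Quotient.mk_eq_zero] at this
    simpa using this

structure MRes {R : Type} [CommRing R] (I A : Ideal R) where
  X : ℕ → ModuleCat.{0} R
  free : ∀ k, Module.Free R (X k)
  d : ∀ k, X (k + 1) →ₗ[R] X k
  e : X 0 →ₗ[R] R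
  e_mem : ∀ z, e z ∈ A
  e_surj : ∀ a ∈ A, ∃ z, e z = a
  ed : ∀ w, e (d 0 w) = 0
  dd : ∀ k w, d k (d (k + 1) w) = 0
  ex0 : ∀ z, e z = 0 → ∃ w, d 0 w = z
  ex : ∀ k z, d k z = 0 → ∃ w, d (k + 1) w = z
  dmin : ∀ k w, d k w ∈ (I • ⊤ : Submodule R (X k))

structure MMap {R : Type} [CommRing R] {I A I' A' : Ideal R} (G : MRes I A) (F : MRes I' A') where
  f : ∀ k, G.X k →ₗ[R] F.X k
  fe : ∀ z, F.e (f 0 z) = G.e z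
  fd : ∀ k z, F.d k (f (k + 1) z) = f k (G.d k z)

noncomputable section

open TensorProduct

variable {R : Type} [CommRing R] 

def MMap.comp {I A I' A' I'' A'' : Ideal R} {G : MRes I A} {F : MRes I' A'} {H : MRes I'' A''}
    (q : MMap F H) (p : MMap G F) : MMap G H where
  f k := q.f k ∘ₗ p.f k
  fe z := by simp [q.fe, p.fe]
  fd k z := by simp [q.fd, p.fd]

/-- terms of the cone -/
def coneX (G F : ℕ → ModuleCat.{0} R) : ℕ → ModuleCat.{0} R
  | 0 => ModuleCat.of R (G 0 × F 0)
  | k + 1 => ModuleCat.of R (G (k + 1) × F (k + 1) × G k)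

def coneD {J I A B : Ideal R} (G : MRes J A) (F : MRes I B) (p : MMap G F) (x : R) :
    ∀ k, coneX G.X F.X (k + 1) →ₗ[R] coneX G.X F.X k
  | 0 => show (G.X 1 × F.X 1 × G.X 0) →ₗ[R] (G.X 0 × F.X 0) from
      { toFun := fun v => (G.d 0 v.1 + x • v.2.2, F.d 0 v.2.1 - p.f 0 v.2.2)
        map_add' := fun v w => by
          ext <;> simp <;> abel
        map_smul' := fun c v => by
          ext <;> simp [smul_sub, smul_comm x c] }
  | k + 1 => show (G.X (k + 2) × F.X (k + 2) × G.X (k + 1)) →ₗ[R]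
        (G.X (k + 1) × F.X (k + 1) × G.X k) from
      { toFun := fun v => (G.d (k + 1) v.1 + x • v.2.2, F.d (k + 1) v.2.1 - p.f (k + 1) v.2.2,
          - G.d k v.2.2)
        map_add' := fun v w => by
          ext <;> simp <;> abel
        map_smul' := fun c v => by
          ext <;> simp [smul_sub, smul_comm x c] }

lemma coneD_zero {J I A B : Ideal R} (G : MRes J A) (F : MRes I B) (p : MMap G F) (x : R)
    (a : G.X 1) (b : F.X 1) (c : G.X 0) :
    coneD G F p x 0 (a, b, c) = (G.d 0 a + x • c, F.d 0 b - p.f 0 c) := rfl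

lemma coneD_succ {J I A B : Ideal R} (G : MRes J A) (F : MRes I B) (p : MMap G F) (x : R) (k : ℕ)
    (a : G.X (k + 2)) (b : F.X (k + 2)) (c : G.X (k + 1)) :
    coneD G F p x (k + 1) (a, b, c) =
      (G.d (k + 1) a + x • c, F.d (k + 1) b - p.f (k + 1) c, - G.d k c) := rfl

lemma prod_mem_smul_top {M N : Type} [AddCommGroup M] [AddCommGroup N] [Module R M] [Module R N]
    (I : Ideal R) {a : M} {b : N} (ha : a ∈ (I • ⊤ : Submodule R M))
    (hb : b ∈ (I • ⊤ : Submodule R N)) : (a, b) ∈ (I • ⊤ : Submodule R (M × N)) := by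
  have h1 := Submodule.mem_map_of_mem (f := LinearMap.inl R M N) ha
  have h2 := Submodule.mem_map_of_mem (f := LinearMap.inr R M N) hb
  rw [Submodule.map_smul''] at h1 h2
  have := add_mem (Submodule.smul_mono le_rfl le_top h1) (Submodule.smul_mono le_rfl le_top h2)
  simpa using this

def cone {J I A B : Ideal R} (hJI : J ≤ I) (G : MRes J A) (F : MRes I B) (p : MMap G F)
    (hp : ∀ k z, p.f k z ∈ (I • ⊤ : Submodule R (F.X k)))
    (x : R) (hxI : x ∈ I) (hx : ∀ b, x * b ∈ A → b ∈ A)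
    (C : Ideal R) (hC : C = A ⊔ Ideal.span {x} * B) : MRes I C where
  X := coneX G.X F.X
  free k := by
    have := G.free
    have := F.free
    cases k
    · exact inferInstanceAs (Module.Free R (G.X 0 × F.X 0))
    · exact inferInstanceAs (Module.Free R (G.X (_ + 1) × F.X (_ + 1) × G.X _))
  d := coneD G F p x
  e := show (G.X 0 × F.X 0) →ₗ[R] R from G.e.coprod (x • F.e)
  e_mem := by
    rintro ⟨a, b⟩
    rw [hC]
    exact Submodule.add_mem_sup (G.e_mem a) (Ideal.mem_span_singleton_mul.2 ⟨_, F.e_mem b, rfl⟩)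
  e_surj := by
    intro c hc
    rw [hC] at hc
    obtain ⟨a, ha, t, ht, rfl⟩ := Submodule.mem_sup.1 hc
    obtain ⟨b, hb, rfl⟩ := Ideal.mem_span_singleton_mul.1 ht
    obtain ⟨a, rfl⟩ := G.e_surj a ha
    obtain ⟨b, rfl⟩ := F.e_surj b hb
    exact ⟨(a, b), rfl⟩
  ed := by
    rintro ⟨a, b, c⟩
    change G.e (G.d 0 a + x • c) + x • F.e (F.d 0 b - p.f 0 c) = 0
    simp [G.ed, F.ed, p.fe]
  dd := by
    rintro (_ | k) ⟨a, b, c⟩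
    · rw [coneD_succ, coneD_zero]
      refine Prod.ext ?_ ?_ <;> simp [G.dd, F.dd, p.fd] <;> rfl
    · rw [coneD_succ, coneD_succ]
      refine Prod.ext ?_ (Prod.ext ?_ ?_) <;> simp [G.dd, F.dd, p.fd] <;> rfl
  ex0 := by
    rintro ⟨a, b⟩ h
    change G.e a + x * F.e b = 0 at h
    have h1 : F.e b ∈ A := hx _ (by
      rw [show x * F.e b = - G.e a by linear_combination h]
      exact neg_mem (G.e_mem a))
    obtain ⟨c, hc⟩ := G.e_surj _ h1
    obtain ⟨b', hb'⟩ := F.ex0 (b - p.f 0 c) (by simp [p.fe, hc])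
    obtain ⟨a', ha'⟩ := G.ex0 (a + x • c) (by simp [hc, h])
    refine ⟨(a', b', -c), ?_⟩
    rw [coneD_zero]
    refine Prod.ext ?_ ?_ <;> simp [ha', hb']
  ex := by
    rintro (_ | k) ⟨a, b, c⟩ h
    · rw [coneD_zero] at h
      have h1 : G.d 0 a + x • c = 0 := congrArg Prod.fst h
      have h2 : F.d 0 b - p.f 0 c = 0 := congrArg Prod.snd h
      have h3 : G.e c = 0 := by rw [← p.fe, ← sub_eq_zero.1 h2, F.ed]
      obtain ⟨c, rfl⟩ := G.ex0 _ h3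
      obtain ⟨b', hb'⟩ := F.ex 0 (b - p.f 1 c) (by simpa [p.fd] using h2)
      obtain ⟨a', ha'⟩ := G.ex 0 (a + x • c) (by simpa using h1)
      refine ⟨(a', b', -c), ?_⟩
      rw [coneD_succ]
      refine Prod.ext ?_ (Prod.ext ?_ ?_) <;> simp [ha', hb']
    · rw [coneD_succ] at h
      have h1 : G.d (k + 1) a + x • c = 0 := congrArg Prod.fst h
      have h2 : F.d (k + 1) b - p.f (k + 1) c = 0 := congrArg (fun v => v.2.1) h
      have h3 : - G.d k c = 0 := congrArg (fun v => v.2.2) h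
      obtain ⟨c, rfl⟩ := G.ex k c (neg_eq_zero.1 h3)
      obtain ⟨b', hb'⟩ := F.ex (k + 1) (b - p.f (k + 2) c) (by simpa [p.fd] using h2)
      obtain ⟨a', ha'⟩ := G.ex (k + 1) (a + x • c) (by simpa using h1)
      refine ⟨(a', b', -c), ?_⟩
      rw [coneD_succ]
      refine Prod.ext ?_ (Prod.ext ?_ ?_) <;> simp [ha', hb']
  dmin := by
    have hG : ∀ k w, G.d k w ∈ (I • ⊤ : Submodule R (G.X k)) := fun k w =>
      Submodule.smul_mono_left hJI (G.dmin k w)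
    rintro (_ | k) ⟨a, b, c⟩
    · rw [coneD_zero]
      exact prod_mem_smul_top I (add_mem (hG _ _) (Submodule.smul_mem_smul hxI trivial))
        (sub_mem (F.dmin _ _) (hp _ _))
    · rw [coneD_succ]
      exact prod_mem_smul_top I (add_mem (hG _ _) (Submodule.smul_mem_smul hxI trivial))
        (prod_mem_smul_top I (sub_mem (F.dmin _ _) (hp _ _)) (neg_mem (hG _ _)))

/-- inclusion into the cone -/
def coneIn {J I A B : Ideal R} (hJI : J ≤ I) (G : MRes J A) (F : MRes I B) (p : MMap G F)
    (hp : ∀ k z, p.f k z ∈ (I • ⊤ : Submodule R (F.X k)))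
    (x : R) (hxI : x ∈ I) (hx : ∀ b, x * b ∈ A → b ∈ A)
    (C : Ideal R) (hC : C = A ⊔ Ideal.span {x} * B) :
    MMap G (cone hJI G F p hp x hxI hx C hC) where
  f k := match k with
    | 0 => show G.X 0 →ₗ[R] (G.X 0 × F.X 0) from LinearMap.inl R _ _
    | k + 1 => show G.X (k + 1) →ₗ[R] (G.X (k + 1) × F.X (k + 1) × G.X k) from LinearMap.inl R _ _
  fe z := by
    change G.e z + x • F.e 0 = _
    simp
  fd k z := by
    cases k with
    | zero => 
      change coneD G F p x 0 (z, 0, 0) = (G.d 0 z, 0)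
      rw [coneD_zero]; simp; rfl
    | succ k =>
      change coneD G F p x (k + 1) (z, 0, 0) = (G.d (k + 1) z, 0, 0)
      rw [coneD_succ]; simp; rfl

/-- map from the cone -/
def coneOut {J I A B : Ideal R} (hJI : J ≤ I) (G : MRes J A) (F : MRes I B) (p : MMap G F)
    (hp : ∀ k z, p.f k z ∈ (I • ⊤ : Submodule R (F.X k)))
    (x : R) (hxI : x ∈ I) (hx : ∀ b, x * b ∈ A → b ∈ A)
    (C : Ideal R) (hC : C = A ⊔ Ideal.span {x} * B) :
    MMap (cone hJI G F p hp x hxI hx C hC) F where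
  f k := match k with
    | 0 => show (G.X 0 × F.X 0) →ₗ[R] F.X 0 from (p.f 0).coprod (x • LinearMap.id)
    | k + 1 => show (G.X (k + 1) × F.X (k + 1) × G.X k) →ₗ[R] F.X (k + 1) from
        (p.f (k + 1)).coprod ((x • LinearMap.id) ∘ₗ LinearMap.fst R _ _)
  fe := by
    rintro ⟨a, b⟩
    change F.e (p.f 0 a + x • b) = G.e a + x • F.e b
    simp [p.fe]
  fd := by
    rintro (_ | k) ⟨a, b, c⟩
    · change F.d 0 (p.f 1 a + x • b) = p.f 0 (G.d 0 a + x • c) + x • (F.d 0 b - p.f 0 c)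
      simp [p.fd, smul_sub]
    · change F.d (k + 1) (p.f (k + 2) a + x • b) =
        p.f (k + 1) (G.d (k + 1) a + x • c) + x • (F.d (k + 1) b - p.f (k + 1) c)
      simp [p.fd, smul_sub]

lemma coneOut_min {J I A B : Ideal R} (hJI : J ≤ I) (G : MRes J A) (F : MRes I B) (p : MMap G F)
    (hp : ∀ k z, p.f k z ∈ (I • ⊤ : Submodule R (F.X k)))
    (x : R) (hxI : x ∈ I) (hx : ∀ b, x * b ∈ A → b ∈ A)
    (C : Ideal R) (hC : C = A ⊔ Ideal.span {x} * B) :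
    ∀ k z, (coneOut hJI G F p hp x hxI hx C hC).f k z ∈ (I • ⊤ : Submodule R (F.X k)) := by
  rintro (_ | k) z
  · obtain ⟨a, b⟩ := z
    exact add_mem (hp _ _) (Submodule.smul_mem_smul hxI trivial)
  · obtain ⟨a, b, c⟩ := z
    exact add_mem (hp _ _) (Submodule.smul_mem_smul hxI trivial)

/-- a family of resolutions of the powers -/
structure Fam (I : Ideal R) where
  F : ∀ s, MRes I (I ^ s)
  p : ∀ s, MMap (F (s + 1)) (F s)
  pmin : ∀ s k z, (p s).f k z ∈ (I • ⊤ : Submodule R ((F s).X k))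

/-- the resolution of the unit ideal -/
def unitRes (I A : Ideal R) (hA : A = ⊤) : MRes I A where
  X k := match k with
    | 0 => ModuleCat.of R R
    | _ + 1 => ModuleCat.of R PUnit
  free k := match k with
    | 0 => inferInstanceAs (Module.Free R R)
    | _ + 1 => inferInstanceAs (Module.Free R PUnit)
  d k := 0
  e := show R →ₗ[R] R from LinearMap.id
  e_mem := by simp [hA]
  e_surj a _ := ⟨a, rfl⟩
  ed w := map_zero _
  dd k w := rfl
  ex0 z h := ⟨0, Eq.symm h⟩
  ex k z _ := ⟨0, rfl⟩
  dmin k w := zero_mem _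

def zeroRes (I A : Ideal R) (hA : A = ⊥) : MRes I A where
  X k := ModuleCat.of R PUnit
  free k := inferInstanceAs (Module.Free R PUnit)
  d k := 0
  e := 0
  e_mem := by simp [hA]
  e_surj a h := ⟨0, by rw [hA] at h; simpa using Eq.symm h⟩
  ed w := map_zero _
  dd k w := rfl
  ex0 z h := ⟨0, rfl⟩
  ex k z _ := ⟨0, rfl⟩
  dmin k w := zero_mem _

def zeroMap (I A I' A' : Ideal R) (hA : A = ⊥) (F : MRes I' A') : MMap (zeroRes I A hA) F where
  f k := 0
  fe z := map_zero _
  fd k z := by simp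

def famBot : Fam (⊥ : Ideal R) where
  F s := match s with
    | 0 => unitRes ⊥ _ (by simp)
    | s + 1 => zeroRes ⊥ _ (by simp [pow_succ])
  p s := zeroMap _ _ _ _ _ _
  pmin s k z := zero_mem _

/-- the map to the unit resolution -/
def toUnit {I A I' A' : Ideal R} (hA : A' = ⊤) (G : MRes I A) : MMap G (unitRes I' A' hA) where
  f k := match k with
    | 0 => show G.X 0 →ₗ[R] R from G.e
    | _ + 1 => 0
  fe _ := rfl
  fd k z := match k with
    | 0 => (G.ed z).symm
    | _ + 1 => rfl


lemma comp_min {J I : Ideal R} (G : Fam J) (hJI : J ≤ I) {s : ℕ} (F : MRes I (I ^ s))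
    (q : MMap (G.F s) F) :
    ∀ k z, (q.comp (G.p s)).f k z ∈ (I • ⊤ : Submodule R (F.X k)) := by
  intro k z
  have h := Submodule.mem_map_of_mem (f := q.f k) (G.pmin s k z)
  rw [Submodule.map_smul''] at h
  exact Submodule.smul_mono hJI le_top h

/-- recursive construction of the resolutions, together with the comparison map -/
def stepAux (J : Ideal R) (y : R) (hy : ∀ s b, y * b ∈ J ^ s → b ∈ J ^ s) (G : Fam J)
    (hp : ∀ s : ℕ, (J ⊔ Ideal.span {y}) ^ (s + 1) =
      J ^ (s + 1) ⊔ Ideal.span {y} * (J ⊔ Ideal.span {y}) ^ s) :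
    ∀ s, Σ F : MRes (J ⊔ Ideal.span {y}) ((J ⊔ Ideal.span {y}) ^ s), MMap (G.F s) F
  | 0 => ⟨unitRes _ _ (by simp), toUnit _ _⟩
  | s + 1 =>
    let q := stepAux J y hy G hp s
    ⟨cone le_sup_left (G.F (s + 1)) q.1 (q.2.comp (G.p s)) (comp_min G le_sup_left q.1 q.2) y
      (Ideal.mem_sup_right (Ideal.mem_span_singleton_self y)) (hy (s + 1)) _ (hp s),
      coneIn _ _ _ _ _ _ _ _ _ _⟩

def famStep (J : Ideal R) (y : R) (hy : ∀ s b, y * b ∈ J ^ s → b ∈ J ^ s) (G : Fam J)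
    (hp : ∀ s : ℕ, (J ⊔ Ideal.span {y}) ^ (s + 1) =
      J ^ (s + 1) ⊔ Ideal.span {y} * (J ⊔ Ideal.span {y}) ^ s) : Fam (J ⊔ Ideal.span {y}) where
  F s := (stepAux J y hy G hp s).1
  p s := coneOut le_sup_left (G.F (s + 1)) (stepAux J y hy G hp s).1
    ((stepAux J y hy G hp s).2.comp (G.p s))
    (comp_min G le_sup_left _ _) y
      (Ideal.mem_sup_right (Ideal.mem_span_singleton_self y)) (hy (s + 1)) _ (hp s)
  pmin s := coneOut_min le_sup_left (G.F (s + 1)) (stepAux J y hy G hp s).1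
    ((stepAux J y hy G hp s).2.comp (G.p s))
    (comp_min G le_sup_left _ _) y
      (Ideal.mem_sup_right (Ideal.mem_span_singleton_self y)) (hy (s + 1)) _ (hp s)

/-- terms of the resolution of the quotient -/
def quotX {I A : Ideal R} (F : MRes I A) : ℕ → ModuleCat.{0} R
  | 0 => ModuleCat.of R R
  | k + 1 => F.X k

def quotD {I A : Ideal R} (F : MRes I A) : ∀ k, quotX F (k + 1) →ₗ[R] quotX F k
  | 0 => F.e
  | k + 1 => F.d k

lemma quotD_min {I A : Ideal R} (F : MRes I A) (hA : A ≤ I) (k : ℕ) (z) :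
    quotD F k z ∈ (I • ⊤ : Submodule R (quotX F k)) := by
  cases k with
  | zero =>
    change F.e z ∈ (I • ⊤ : Submodule R R)
    simpa using hA (F.e_mem z)
  | succ k => exact F.dmin k z

lemma quotD_exact {I A : Ideal R} (F : MRes I A) (k : ℕ) :
    Function.Exact (quotD F (k + 1)) (quotD F k) := by
  intro z
  cases k with
  | zero => exact ⟨F.ex0 z, by rintro ⟨w, rfl⟩; exact F.ed w⟩
  | succ k => exact ⟨F.ex k z, by rintro ⟨w, rfl⟩; exact F.dd k w⟩

instance quotX_free {I A : Ideal R} (F : MRes I A) (k : ℕ) : Module.Free R (quotX F k) := by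
  cases k with
  | zero => exact inferInstanceAs (Module.Free R R)
  | succ k => exact F.free k

def quotC {I A : Ideal R} (F : MRes I A) : ChainComplex (ModuleCat.{0} R) ℕ :=
  ChainComplex.of (quotX F) (fun k => ModuleCat.ofHom (quotD F k)) (fun k => by
    ext z
    exact (quotD_exact F k).apply_apply_eq_zero z)

lemma quotC_d {I A : Ideal R} (F : MRes I A) (k : ℕ) :
    (quotC F).d (k + 1) k = ModuleCat.ofHom (quotD F k) := by
  exact ChainComplex.of_d (quotX F) (fun k => ModuleCat.ofHom (quotD F k)) k

def quotP {I A : Ideal R} (F : MRes I A) : ProjectiveResolution (ModuleCat.of R (R ⧸ A)) where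
  complex := quotC F
  projective k := by
    have := quotX_free F k
    exact (IsProjective.iff_projective (R := R) (quotX F k)).1 Module.Projective.of_free
  π := (ChainComplex.toSingle₀Equiv _ _).symm ⟨ModuleCat.ofHom (A.mkQ), by
    rw [quotC_d]
    ext z
    exact (Submodule.Quotient.mk_eq_zero _).2 (F.e_mem z)⟩
  quasiIso := ⟨fun n => by
    cases n
    · rw [ChainComplex.quasiIsoAt₀_iff, ShortComplex.quasiIso_iff_of_zeros' _ rfl rfl rfl]
      constructor
      · rw [ShortComplex.moduleCat_exact_iff]
        intro z hz
        change A.mkQ (show R from z) = 0 at hz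
        obtain ⟨w, hw⟩ := F.e_surj z ((Submodule.Quotient.mk_eq_zero _).1 hz)
        refine ⟨w, ?_⟩
        change ((quotC F).d 1 0) w = z
        rw [quotC_d]
        exact hw
      · rw [ModuleCat.epi_iff_surjective]
        exact A.mkQ_surjective
    · rename_i m
      rw [quasiIsoAt_iff_exactAt' (hL := ChainComplex.exactAt_succ_single_obj ..),
          HomologicalComplex.exactAt_iff' _ (m + 2) (m + 1) m (by simp) (by simp)]
      rw [ShortComplex.moduleCat_exact_iff]
      intro z hz
      change ((quotC F).d (m + 1) m) z = 0 at hz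
      rw [quotC_d] at hz
      obtain ⟨w, hw⟩ := (quotD_exact F m z).1 hz
      refine ⟨w, ?_⟩
      change ((quotC F).d (m + 2) (m + 1)) w = z
      rw [quotC_d]
      exact hw⟩

lemma lTensor_zero {M N : Type} [AddCommGroup M] [AddCommGroup N] [Module R M] [Module R N]
    (I : Ideal R) (f : M →ₗ[R] N) (hf : ∀ z, f z ∈ (I • ⊤ : Submodule R N)) :
    f.lTensor (R ⧸ I) = 0 := by
  apply TensorProduct.ext'
  intro a z
  rw [LinearMap.lTensor_tmul, LinearMap.zero_apply]
  have : ∀ v ∈ (I • ⊤ : Submodule R N), a ⊗ₜ[R] v = 0 := by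
    intro v hv
    refine Submodule.smul_induction_on hv ?_ ?_
    · intro r hr n _
      rw [← TensorProduct.smul_tmul]
      obtain ⟨a, rfl⟩ := Ideal.Quotient.mk_surjective a
      have : r • (Ideal.Quotient.mk I a) = 0 := by
        change Ideal.Quotient.mk I (r * a) = 0
        exact Ideal.Quotient.eq_zero_iff_mem.2 (Ideal.mul_mem_right _ _ hr)
      rw [this, TensorProduct.zero_tmul]
    · intro u v hu hv
      rw [TensorProduct.tmul_add, hu, hv, add_zero]
  exact this _ (hf z)

open MonoidalCategory in
def torIso {I A : Ideal R} (F : MRes I A) (hA : A ≤ I) (k : ℕ) :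
    ((Tor (ModuleCat R) k).obj (ModuleCat.of R (R ⧸ I))).obj (ModuleCat.of R (R ⧸ A)) ≅
      (ModuleCat.of R (R ⧸ I)) ⊗ (quotX F k) :=
  have h0 : ∀ i j, ((((tensoringLeft (ModuleCat R)).obj
      (ModuleCat.of R (R ⧸ I))).mapHomologicalComplex (ComplexShape.down ℕ)).obj
        (quotC F)).d i j = 0 := by
    intro i j
    by_cases hij : j + 1 = i
    · subst hij
      change (ModuleCat.of R (R ⧸ I)) ◁ (quotC F).d (j + 1) j = 0
      rw [quotC_d]
      ext1
      exact lTensor_zero I (quotD F j) (quotD_min F hA j)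
    · exact HomologicalComplex.shape _ _ _ hij
  (quotP F).isoLeftDerivedObj ((tensoringLeft (ModuleCat R)).obj (ModuleCat.of R (R ⧸ I))) k ≪≫
    (ShortComplex.HomologyData.ofZeros ((((((tensoringLeft (ModuleCat R)).obj
      (ModuleCat.of R (R ⧸ I))).mapHomologicalComplex (ComplexShape.down ℕ)).obj
        (quotC F))).sc k) (h0 _ _) (h0 _ _)).left.homologyIso

end

lemma exists_fam {R : Type} [CommRing R] {I : Ideal R} (h : RegIdeal I) : Nonempty (Fam I) := by
  induction h with
  | bot => exact ⟨famBot⟩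
  | step J y hJ hy ih =>
    obtain ⟨G⟩ := ih
    exact ⟨famStep J y (reg_pow J hJ.key y hy) G (sup_pow_succ J y)⟩

open TensorProduct

/-- Let `r : Fin n → R` be a regular sequence generating the ideal `I`.
For all `s ≥ 1` and `k ≥ 0`, the `R/I`-module `Tor_k^R(R/I, R/I^s)` is free
(for any `R/I`-module structure compatible with the `R`-module structure). -/
theorem stmt_5 (R : Type) [CommRing R] {n : ℕ} (r : Fin n → R)
    (hreg : RingTheory.Sequence.IsRegular R (List.ofFn r))
    (I : Ideal R) (hI : I = Ideal.span (Set.range r)) (s : ℕ) (hs : 1 ≤ s) (k : ℕ)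
    [Module (R ⧸ I) ((TorF R I k).obj (ModuleCat.of R (R ⧸ (I ^ s))))]
    [IsScalarTower R (R ⧸ I) ((TorF R I k).obj (ModuleCat.of R (R ⧸ (I ^ s))))] :
    Module.Free (R ⧸ I) ((TorF R I k).obj (ModuleCat.of R (R ⧸ (I ^ s)))) := by
  have hI' : I = Ideal.ofList (List.ofFn r) := by
    rw [hI, Ideal.ofList]
    congr 1
    ext x
    simp [List.mem_ofFn]
  have hR : RegIdeal I := hI' ▸ regIdeal_of _ hreg.toIsWeaklyRegular
  obtain ⟨G⟩ := exists_fam hR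
  have hA : I ^ s ≤ I := Ideal.pow_le_self (by omega)
  let e : ((TorF R I k).obj (ModuleCat.of R (R ⧸ (I ^ s)))) ≃ₗ[R]
      ((R ⧸ I) ⊗[R] (quotX (G.F s) k)) := (torIso (G.F s) hA k).toLinearEquiv
  have e' := e.extendScalarsOfSurjective (S := R ⧸ I) Ideal.Quotient.mk_surjective
  exact Module.Free.of_equiv e'.symm
end
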